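/- Let K∈ℕ with K≥2 and 0<p<∞. Then there exists a constant C=C(K,p)>0 such that for every function f analytic on 𝔻 and every j∈ℕ∪{0}, ∑_{l=0}^{K^{j+3}−1} (sup_{z∈Q_{j,l}} |f(z)|)^p ≤ C K^j M_p^p(r_{j+2}, f). -/

import Mathlib

open Complex MeasureTheory
open scoped Real

noncomputable section

/-- The radii `r_j = 1 − K^{−j}`. -/
def rK (K : ℕ) (j : ℕ) : ℝ := 1 - ((K : ℝ) ^ j)⁻¹

/-- The dyadic polar rectangle `Q_{j,l}`. -/
def Qset (K j l : ℕ) : Set ℂ :=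
  {w : ℂ | rK K j ≤ ‖w‖ ∧ ‖w‖ < rK K (j + 1) ∧
    ∃ θ : ℝ, 2 * Real.pi * l / (K : ℝ) ^ (j + 3) ≤ θ ∧
      θ < 2 * Real.pi * (l + 1) / (K : ℝ) ^ (j + 3) ∧
      w = (‖w‖ : ℂ) * Complex.exp ((θ : ℂ) * Complex.I)}

/-- The point `r e^{it}` of the circle of radius `r`. -/
def circ (r t : ℝ) : ℂ := (r : ℂ) * Complex.exp ((t : ℂ) * Complex.I)

/-- The integral mean `M_p(r,f)` for `0 < p < ∞`. -/
def MpR (p : ℝ) (f : ℂ → ℂ) (r : ℝ) : ℝ :=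
  ((2 * Real.pi)⁻¹ *
      ∫ t in (0:ℝ)..(2 * Real.pi), ‖f (circ r t)‖ ^ p) ^ p⁻¹

theorem exists_finset_prod_factorization {f : ℂ → ℂ} {R : ℝ} (hR : 0 < R)
    (hf : AnalyticOnNhd ℂ f (Metric.closedBall 0 R)) {w : ℂ}
    (hw : w ∈ Metric.closedBall 0 R) (hfw : f w ≠ 0) :
    ∃ (s : Finset ℂ) (n : ℂ → ℕ) (g : ℂ → ℂ), (∀ u ∈ s, ‖u‖ ≤ R) ∧
      AnalyticOnNhd ℂ g (Metric.closedBall 0 R) ∧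
      (∀ z ∈ Metric.closedBall 0 R, g z ≠ 0) ∧
      ∀ z ∈ Metric.closedBall 0 R, f z = (∏ u ∈ s, (z - u) ^ n u) * g z := by
  have hconn : IsPreconnected (Metric.closedBall (0 : ℂ) R) :=
    (convex_closedBall (0 : ℂ) R).isPreconnected
  have hord : ∀ u : Metric.closedBall (0 : ℂ) R, meromorphicOrderAt f u ≠ ⊤ := by
    rintro ⟨u, hu⟩ h
    rw [(hf u hu).meromorphicOrderAt_eq] at h
    simp only [ENat.map_eq_top_iff, analyticOrderAt_eq_top] at h
    exact hfw (hf.eqOn_zero_of_preconnected_of_eventuallyEq_zero hconn hu h hw)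
  set D := MeromorphicOn.divisor f (Metric.closedBall 0 R) with hD
  have hfin : D.support.Finite := D.finiteSupport (isCompact_closedBall 0 R)
  obtain ⟨g, hg, hg0, hfg⟩ := hf.meromorphicOn.extract_zeros_poles hord hfin
  have hDnn : 0 ≤ D := MeromorphicOn.AnalyticOnNhd.divisor_nonneg hf
  have hprod : (∏ᶠ u, (· - u) ^ D u : ℂ → ℂ) =
      fun z ↦ ∏ u ∈ hfin.toFinset, (z - u) ^ (D u).toNat := by
    rw [finprod_eq_prod_of_mulSupport_subset (s := hfin.toFinset)]
    · ext z
      rw [Finset.prod_apply]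
      refine Finset.prod_congr rfl fun u _ ↦ ?_
      have h0 : 0 ≤ D u := hDnn u
      rw [Pi.pow_apply, ← zpow_natCast, Int.toNat_of_nonneg h0]
    · intro u hu
      contrapose! hu
      have : D u = 0 := by simpa using hu
      simp [this]
  refine ⟨hfin.toFinset, fun u ↦ (D u).toNat, g, ?_, hg, fun z hz ↦ hg0 ⟨z, hz⟩, ?_⟩
  · intro u hu
    have : u ∈ D.support := by simpa using hu
    simpa using D.supportWithinDomain this
  · have h0 : (0 : ℂ) ∈ Metric.closedBall 0 R := by simp [hR.le]
    refine hf.eqOn_of_preconnected_of_frequently_eq (g := fun z ↦ _ * g z)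
      (fun z hz ↦ ?_) hconn h0 ?_
    · exact (by fun_prop : AnalyticAt ℂ
        (fun z ↦ ∏ u ∈ hfin.toFinset, (z - u) ^ (D u).toNat) z).mul (hg z hz)
    · rw [hprod] at hfg
      have h1 := mem_codiscreteWithin_iff_forall_mem_nhdsNE.1 hfg 0 h0
      have h2 : ∀ᶠ z in nhdsWithin (0 : ℂ) {0}ᶜ, z ∈ Metric.closedBall (0 : ℂ) R :=
        nhdsWithin_le_nhds (Metric.closedBall_mem_nhds 0 hR)
      refine Filter.Eventually.frequently ?_
      filter_upwards [h1, h2] with z hz hz2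
      rcases hz with h | h
      · simpa using h
      · exact absurd hz2 h

theorem norm_sub_mul_le_norm_sq_sub_conj_mul {R : ℝ} {u z : ℂ} (hu : ‖u‖ ≤ R)
    (hz : ‖z‖ ≤ R) : R * ‖z - u‖ ≤ ‖(R : ℂ) ^ 2 - (starRingEnd ℂ) u * z‖ := by
  have hR : 0 ≤ R := (norm_nonneg u).trans hu
  refine (sq_le_sq₀ (by positivity) (norm_nonneg _)).1 ?_
  rw [mul_pow, Complex.sq_norm, Complex.sq_norm]
  have hu2 : u.re ^ 2 + u.im ^ 2 ≤ R ^ 2 := by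
    have := pow_le_pow_left₀ (norm_nonneg u) hu 2
    rwa [Complex.sq_norm, normSq_apply, ← sq, ← sq] at this
  have hz2 : z.re ^ 2 + z.im ^ 2 ≤ R ^ 2 := by
    have := pow_le_pow_left₀ (norm_nonneg z) hz 2
    rwa [Complex.sq_norm, normSq_apply, ← sq, ← sq] at this
  simp only [normSq_apply, sub_re, sub_im, mul_re, mul_im, conj_re, conj_im, ← ofReal_pow,
    ofReal_re, ofReal_im]
  nlinarith [mul_nonneg (sub_nonneg.2 hu2) (sub_nonneg.2 hz2)]

theorem norm_sq_sub_conj_mul_of_norm_eq {R : ℝ} {u z : ℂ} (hz : ‖z‖ = R) :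
    ‖(R : ℂ) ^ 2 - (starRingEnd ℂ) u * z‖ = R * ‖z - u‖ := by
  have h : (R : ℂ) ^ 2 - (starRingEnd ℂ) u * z = (starRingEnd ℂ) (z - u) * z := by
    rw [map_sub, sub_mul, ← normSq_eq_conj_mul_self, normSq_eq_norm_sq, hz]; push_cast; ring
  rw [h, norm_mul, RCLike.norm_conj, hz, mul_comm]

/-- An analytic function is dominated on the disc by an analytic function which has no zeros in
the open disc and the same modulus on the circle. -/
theorem exists_zeroFree_majorant {f : ℂ → ℂ} {R : ℝ} (hR : 0 < R)
    (hf : AnalyticOnNhd ℂ f (Metric.closedBall 0 R)) {w : ℂ}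
    (hw : w ∈ Metric.closedBall 0 R) (hfw : f w ≠ 0) :
    ∃ G : ℂ → ℂ, AnalyticOnNhd ℂ G (Metric.closedBall 0 R) ∧
      (∀ z ∈ Metric.ball 0 R, G z ≠ 0) ∧
      (∀ z ∈ Metric.closedBall 0 R, ‖f z‖ ≤ ‖G z‖) ∧
      ∀ z ∈ Metric.sphere 0 R, ‖G z‖ = ‖f z‖ := by
  obtain ⟨s, n, g, hs, hg, hg0, hfg⟩ := exists_finset_prod_factorization hR hf hw hfw
  have hRC : (R : ℂ) ≠ 0 := by exact_mod_cast hR.ne'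
  refine ⟨fun z ↦ (∏ u ∈ s, (((R : ℂ) ^ 2 - (starRingEnd ℂ) u * z) / R) ^ n u) * g z,
    fun z hz ↦ ?_, fun z hz ↦ ?_, fun z hz ↦ ?_, fun z hz ↦ ?_⟩
  · exact (by fun_prop (disch := exact hRC) : AnalyticAt ℂ
      (fun z ↦ ∏ u ∈ s, (((R : ℂ) ^ 2 - (starRingEnd ℂ) u * z) / R) ^ n u) z).mul (hg z hz)
  · refine mul_ne_zero (Finset.prod_ne_zero_iff.2 fun u hu ↦ pow_ne_zero _ (div_ne_zero ?_ hRC))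
      (hg0 z (Metric.ball_subset_closedBall hz))
    intro h
    have hz' : ‖z‖ < R := by simpa using hz
    have h1 : ‖(starRingEnd ℂ) u * z‖ = R ^ 2 := by
      rw [← sub_eq_zero.1 h]; simp [abs_of_pos hR]
    rw [norm_mul, RCLike.norm_conj] at h1
    nlinarith [hs u hu, norm_nonneg u, norm_nonneg z]
  · rw [hfg z hz, norm_mul, norm_mul, norm_prod, norm_prod]
    gcongr with u hu
    rw [norm_pow, norm_pow]
    gcongr
    rw [norm_div, norm_real, Real.norm_of_nonneg hR.le, le_div_iff₀ hR, mul_comm]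
    exact norm_sub_mul_le_norm_sq_sub_conj_mul (hs u hu) (by simpa using hz)
  · rw [hfg z (Metric.sphere_subset_closedBall hz), norm_mul, norm_mul, norm_prod, norm_prod]
    congr 1
    refine Finset.prod_congr rfl fun u hu ↦ ?_
    rw [norm_pow, norm_pow, norm_div, norm_real, Real.norm_of_nonneg hR.le,
      norm_sq_sub_conj_mul_of_norm_eq (by simpa using hz), mul_div_cancel_left₀ _ hR.ne']

theorem poissonKernel_nonneg {w z : ℂ} (h : ‖w‖ ≤ ‖z‖) : 0 ≤ poissonKernel 0 w z := by
  rw [poissonKernel_def]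
  simp only [sub_zero]
  have := pow_le_pow_left₀ (norm_nonneg w) h 2
  exact div_nonneg (by linarith) (by positivity)

theorem continuousOn_poissonKernel (w : ℂ) (R : ℝ) :
    ContinuousOn (poissonKernel 0 w) {z | ‖z - 0‖ ∈ Set.Ioc ‖w‖ R} := by
  intro z hz
  have hne : ‖z - w‖ ^ 2 ≠ 0 := by
    refine pow_ne_zero _ (norm_ne_zero_iff.2 (sub_ne_zero.2 ?_))
    rintro rfl
    simp at hz
  have : poissonKernel 0 w = fun z ↦ (‖z‖ ^ 2 - ‖w‖ ^ 2) / ‖z - w‖ ^ 2 := by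
    ext z; simp [poissonKernel_def]
  rw [this]
  exact ContinuousAt.continuousWithinAt (by fun_prop (disch := exact hne))

theorem rpow_norm_le_circleAverage_of_zeroFree {G : ℂ → ℂ} {R p : ℝ} (hp : 0 < p)
    (hG : AnalyticOnNhd ℂ G (Metric.closedBall 0 R))
    (hG0 : ∀ z ∈ Metric.ball 0 R, G z ≠ 0) {w : ℂ} (hw : w ∈ Metric.ball 0 R) :
    ‖G w‖ ^ p ≤ Real.circleAverage (fun z ↦ poissonKernel 0 w z * ‖G z‖ ^ p) 0 R := by
  have hwR : ‖w‖ < R := by simpa using hw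
  obtain ⟨F, hF, hFG⟩ := InnerProductSpace.HarmonicOnNhd.exists_analyticOnNhd_ball_re_eq
    (f := fun z ↦ Real.log ‖G z‖) (z := 0) (R := R)
    (fun x hx ↦ (hG x (Metric.ball_subset_closedBall hx)).harmonicAt_log_norm (hG0 x hx))
  have hnorm : ∀ z ∈ Metric.ball (0 : ℂ) R, ‖Complex.exp (p * F z)‖ = ‖G z‖ ^ p := by
    intro z hz
    have := hFG hz
    dsimp only at this
    rw [Complex.norm_exp, re_ofReal_mul, this,
      Real.rpow_def_of_pos (norm_pos_iff.2 (hG0 z hz)), mul_comm]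
  have hcont : ContinuousOn (fun z ↦ poissonKernel 0 w z * ‖G z‖ ^ p)
      {z | ‖z - 0‖ ∈ Set.Ioc ‖w‖ R} := by
    refine (continuousOn_poissonKernel w R).mul (ContinuousOn.rpow_const ?_ fun _ _ ↦ Or.inr hp.le)
    exact (hG.continuousOn.mono fun z hz ↦ by simpa using hz.2).norm
  have hav := Real.ContinuousOn.circleAverage hcont (fun r hr ↦ (norm_nonneg w).trans hr.1.le)
  have hlim : Filter.Tendsto (Real.circleAverage (fun z ↦ poissonKernel 0 w z * ‖G z‖ ^ p) 0)
      (nhdsWithin R (Set.Ioo ‖w‖ R))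
      (nhds (Real.circleAverage (fun z ↦ poissonKernel 0 w z * ‖G z‖ ^ p) 0 R)) :=
    (hav R (Set.right_mem_Ioc.2 hwR)).mono_left (nhdsWithin_mono _ Set.Ioo_subset_Ioc_self)
  have : (nhdsWithin R (Set.Ioo ‖w‖ R)).NeBot := right_nhdsWithin_Ioo_neBot hwR
  refine ge_of_tendsto hlim ?_
  filter_upwards [self_mem_nhdsWithin] with r hr
  have hr0 : 0 < r := (norm_nonneg w).trans_lt hr.1
  have hsub : Metric.closedBall (0 : ℂ) r ⊆ Metric.ball 0 R := Metric.closedBall_subset_ball hr.2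
  have hd : DiffContOnCl ℂ (fun z ↦ Complex.exp (p * F z)) (Metric.ball 0 r) := by
    refine DifferentiableOn.diffContOnCl fun z hz ↦ ?_
    have := (hF z (hsub (Metric.closure_ball_subset_closedBall hz))).differentiableAt
    exact (by fun_prop :
      DifferentiableAt ℂ (fun z ↦ Complex.exp (p * F z)) z).differentiableWithinAt
  have hP := hd.circleAverage_poissonKernel_smul (w := w) (by simpa using hr.1)
  rw [← hnorm w hw, ← hP, Real.circleAverage_def, Real.circleAverage_def, norm_smul, smul_eq_mul,
    Real.norm_of_nonneg (by positivity)]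
  gcongr
  refine (intervalIntegral.norm_integral_le_integral_norm (by positivity)).trans (le_of_eq ?_)
  refine intervalIntegral.integral_congr fun t _ ↦ ?_
  have hc : ‖circleMap 0 r t‖ = r := by simp [abs_of_pos hr0]
  simp only [Pi.smul_apply', norm_smul]
  rw [hnorm _ (hsub (by simp [abs_of_pos hr0])),
    Real.norm_of_nonneg (poissonKernel_nonneg (by rw [hc]; exact hr.1.le))]

/-- Poisson majorization of `‖f‖ ^ p` for analytic `f`. -/
theorem rpow_norm_le_circleAverage_poissonKernel {f : ℂ → ℂ} {R p : ℝ} (hp : 0 < p)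
    (hf : AnalyticOnNhd ℂ f (Metric.closedBall 0 R)) {w : ℂ} (hw : w ∈ Metric.ball 0 R) :
    ‖f w‖ ^ p ≤ Real.circleAverage (fun z ↦ poissonKernel 0 w z * ‖f z‖ ^ p) 0 R := by
  have hwR : ‖w‖ < R := by simpa using hw
  have hR : 0 < R := (norm_nonneg w).trans_lt hwR
  by_cases hfw : f w = 0
  · rw [hfw, norm_zero, Real.zero_rpow hp.ne']
    refine Real.circleAverage_nonneg_of_nonneg fun z hz ↦ mul_nonneg (poissonKernel_nonneg ?_)
      (by positivity)
    have : ‖z‖ = R := by simpa [abs_of_pos hR] using hz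
    rw [this]; exact hwR.le
  obtain ⟨G, hG, hG0, hfG, hGf⟩ :=
    exists_zeroFree_majorant hR hf (Metric.ball_subset_closedBall hw) hfw
  calc ‖f w‖ ^ p ≤ ‖G w‖ ^ p := by
        gcongr; exact hfG w (Metric.ball_subset_closedBall hw)
    _ ≤ _ := rpow_norm_le_circleAverage_of_zeroFree hp hG hG0 hw
    _ = _ := Real.circleAverage_congr_sphere fun z hz ↦ by
        rw [abs_of_pos hR] at hz
        simp only [hGf z hz]

theorem integral_poissonKernel_circleMap {r R : ℝ} (hr : 0 ≤ r) (hrR : r < R) (t : ℝ) :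
    ∫ θ in (0 : ℝ)..(2 * π), poissonKernel 0 (circleMap 0 r θ) (circleMap 0 R t) = 2 * π := by
  have hR : 0 < R := hr.trans_lt hrR
  have hd : DiffContOnCl ℂ (fun _ : ℂ ↦ (1 : ℂ)) (Metric.ball 0 R) := diffContOnCl_const
  have hw : circleMap 0 r t ∈ Metric.ball (0 : ℂ) R := by simpa [abs_of_nonneg hr] using hrR
  have h := hd.circleAverage_poissonKernel_smul hw
  have hsymm : ∀ θ : ℝ, poissonKernel 0 (circleMap 0 r θ) (circleMap 0 R t) =
      poissonKernel 0 (circleMap 0 r t) (circleMap 0 R θ) := by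
    intro θ
    have key : ‖circleMap 0 R t - circleMap 0 r θ‖ = ‖circleMap 0 R θ - circleMap 0 r t‖ := by
      have hcθ : (starRingEnd ℂ) (Complex.exp (θ * I)) * Complex.exp (θ * I) = 1 := by
        rw [← normSq_eq_conj_mul_self, normSq_eq_norm_sq, norm_exp_ofReal_mul_I]; simp
      have hct : (starRingEnd ℂ) (Complex.exp (t * I)) * Complex.exp (t * I) = 1 := by
        rw [← normSq_eq_conj_mul_self, normSq_eq_norm_sq, norm_exp_ofReal_mul_I]; simp
      have : circleMap 0 R θ - circleMap 0 r t =
          (starRingEnd ℂ) (circleMap 0 R t - circleMap 0 r θ) *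
            (Complex.exp (t * I) * Complex.exp (θ * I)) := by
        simp only [circleMap, zero_add, map_sub, map_mul, conj_ofReal]
        linear_combination (-(R : ℂ) * Complex.exp (θ * I)) * hct +
          (r : ℂ) * Complex.exp (t * I) * hcθ
      rw [this, norm_mul, norm_mul, RCLike.norm_conj, norm_exp_ofReal_mul_I,
        norm_exp_ofReal_mul_I]
      ring
    simp only [poissonKernel_def, sub_zero, norm_circleMap_zero, key]
  simp_rw [hsymm]
  have h' : Real.circleAverage (fun z ↦ poissonKernel 0 (circleMap 0 r t) z) 0 R = 1 := by
    have hint : CircleIntegrable (poissonKernel 0 (circleMap 0 r t)) 0 R := by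
      refine ContinuousOn.circleIntegrable hR.le
        ((continuousOn_poissonKernel (circleMap 0 r t) R).mono fun z hz ↦ ?_)
      have hz' : ‖z‖ = R := by simpa using hz
      simp [hz', abs_of_nonneg hr, hrR]
    have := ofRealCLM.circleAverage_comp_comm hint
    apply Complex.ofReal_injective
    rw [ofRealCLM_apply] at this
    rw [ofReal_one, ← h]
    refine this.symm.trans (congrArg (fun f ↦ Real.circleAverage f 0 R) ?_)
    ext z
    simp
  rw [Real.circleAverage_def, smul_eq_mul] at h'
  field_simp at h'
  linarith

theorem poissonKernel_le_mul {R a m M : ℝ} {w w' ζ : ℂ} (hζ : ‖ζ‖ = R) (ha : 0 < a)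
    (hm : 0 ≤ m) (hM : 0 ≤ M) (hwa : a ≤ R - ‖w‖) (hw' : ‖w'‖ < R)
    (hww' : ‖w - w'‖ ≤ m * a) (hnum : R ^ 2 - ‖w‖ ^ 2 ≤ M * (R ^ 2 - ‖w'‖ ^ 2)) :
    poissonKernel 0 w ζ ≤ M * (1 + m) ^ 2 * poissonKernel 0 w' ζ := by
  simp only [poissonKernel_def, sub_zero, hζ]
  have h1 : R - ‖w‖ ≤ ‖ζ - w‖ := hζ ▸ norm_sub_norm_le ζ w
  have h2 : R - ‖w'‖ ≤ ‖ζ - w'‖ := hζ ▸ norm_sub_norm_le ζ w'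
  have hpos : 0 < ‖ζ - w‖ := by linarith
  have hpos' : 0 < ‖ζ - w'‖ := by linarith
  have h3 : ‖ζ - w'‖ ≤ (1 + m) * ‖ζ - w‖ := by
    have : ‖ζ - w'‖ ≤ ‖ζ - w‖ + ‖w - w'‖ := by simpa using norm_add_le (ζ - w) (w - w')
    have : m * a ≤ m * ‖ζ - w‖ := by gcongr; linarith
    linarith
  have hn : 0 ≤ R ^ 2 - ‖w'‖ ^ 2 := by nlinarith [norm_nonneg w']
  have h4 : ‖ζ - w'‖ ^ 2 ≤ (1 + m) ^ 2 * ‖ζ - w‖ ^ 2 := by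
    rw [← mul_pow]; gcongr
  rw [div_le_iff₀ (by positivity), mul_div_assoc', div_mul_eq_mul_div, le_div_iff₀ (by positivity)]
  calc (R ^ 2 - ‖w‖ ^ 2) * ‖ζ - w'‖ ^ 2
      ≤ (M * (R ^ 2 - ‖w'‖ ^ 2)) * ((1 + m) ^ 2 * ‖ζ - w‖ ^ 2) := by gcongr
    _ = _ := by ring

theorem norm_circleMap_sub_circleMap_le (ρ r θ φ : ℝ) :
    ‖circleMap 0 ρ θ - circleMap 0 r φ‖ ≤ |ρ - r| + |r| * |θ - φ| := by
  have h1 : ‖circleMap 0 ρ θ - circleMap 0 r θ‖ = |ρ - r| := by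
    simp only [circleMap, zero_add]
    rw [← sub_mul, norm_mul, norm_exp_ofReal_mul_I, ← ofReal_sub, norm_real, mul_one,
      Real.norm_eq_abs]
  have h2 : ‖circleMap 0 r θ - circleMap 0 r φ‖ ≤ |r| * |θ - φ| := by
    have := (lipschitzWith_circleMap (0 : ℂ) r).dist_le_mul θ φ
    simpa [dist_eq_norm, Real.norm_eq_abs] using this
  calc _ = ‖(circleMap 0 ρ θ - circleMap 0 r θ) + (circleMap 0 r θ - circleMap 0 r φ)‖ := by
        congr 1; ring
    _ ≤ _ := (norm_add_le _ _).trans (by rw [h1]; gcongr)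

theorem sum_le_of_le_mul_on_arcs {N : ℕ} (hN : 0 < N) {A : ℝ} {c : ℕ → ℝ} {g : ℝ → ℝ}
    (hg : Continuous g)
    (h : ∀ l < N, ∀ θ ∈ Set.Icc (2 * π * l / N) (2 * π * (l + 1) / N), c l ≤ A * g θ) :
    ∑ l ∈ Finset.range N, c l ≤ N / (2 * π) * (A * ∫ θ in (0 : ℝ)..(2 * π), g θ) := by
  have hN' : (0 : ℝ) < N := by exact_mod_cast hN
  have hstep : ∀ l < N, 2 * π / N * c l ≤
      ∫ θ in (2 * π * (l : ℕ) / N)..(2 * π * ((l + 1 : ℕ) : ℝ) / N), A * g θ := by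
    intro l hl
    have hle : 2 * π * (l : ℕ) / N ≤ 2 * π * ((l + 1 : ℕ) : ℝ) / N := by
      push_cast; gcongr; linarith
    have := intervalIntegral.integral_mono_on (f := fun _ ↦ c l) (g := fun θ ↦ A * g θ)
      (μ := volume) hle (by simp) ((continuous_const.mul hg).intervalIntegrable _ _)
      (fun θ hθ ↦ h l hl θ (by simpa using hθ))
    rw [intervalIntegral.integral_const, smul_eq_mul] at this
    refine le_trans (le_of_eq ?_) this
    push_cast
    ring
  have hsum : 2 * π / N * ∑ l ∈ Finset.range N, c l ≤ A * ∫ θ in (0 : ℝ)..(2 * π), g θ := by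
    rw [Finset.mul_sum, ← intervalIntegral.integral_const_mul]
    refine (Finset.sum_le_sum fun l hl ↦ hstep l (Finset.mem_range.1 hl)).trans (le_of_eq ?_)
    rw [intervalIntegral.sum_integral_adjacent_intervals (f := fun θ ↦ A * g θ)
      (a := fun l : ℕ ↦ 2 * π * (l : ℝ) / N)
      fun l _ ↦ (continuous_const.mul hg).intervalIntegrable _ _]
    simp [hN'.ne']
  calc ∑ l ∈ Finset.range N, c l
      = N / (2 * π) * (2 * π / N * ∑ l ∈ Finset.range N, c l) := by field_simp
    _ ≤ _ := by gcongr

theorem sum_poissonKernel_le {K j : ℕ} (hK : 2 ≤ K) {ρ φ : ℕ → ℝ}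
    (hρ : ∀ l < K ^ (j + 3), ρ l ∈ Set.Icc (rK K j) (rK K (j + 1)))
    (hφ : ∀ l < K ^ (j + 3), φ l ∈
      Set.Icc (2 * π * l / (K : ℝ) ^ (j + 3)) (2 * π * (l + 1) / (K : ℝ) ^ (j + 3))) (t : ℝ) :
    ∑ l ∈ Finset.range (K ^ (j + 3)),
        poissonKernel 0 (circleMap 0 (ρ l) (φ l)) (circleMap 0 (rK K (j + 2)) t) ≤
      3 * (K : ℝ) ^ 2 * (1 + 8 * (K : ℝ) ^ 2) ^ 2 * (K : ℝ) ^ (j + 3) := by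
  have hK2 : (2 : ℝ) ≤ K := by exact_mod_cast hK
  have hK0 : (0 : ℝ) < K := by linarith
  obtain ⟨a, ha⟩ : ∃ a : ℝ, a = ((K : ℝ) ^ (j + 2))⁻¹ := ⟨_, rfl⟩
  have ha0 : 0 < a := by rw [ha]; positivity
  have h0 : rK K j = 1 - K ^ 2 * a := by
    rw [rK, ha, pow_add]; field_simp
  have h1 : rK K (j + 1) = 1 - K * a := by
    rw [rK, ha, show j + 2 = j + 1 + 1 from rfl, pow_succ _ (j + 1), mul_inv_rev,
      mul_inv_cancel_left₀ hK0.ne']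
  have h2 : rK K (j + 2) = 1 - a := by rw [rK, ha]
  have haK : (K : ℝ) ^ 2 * a ≤ 1 := by
    rw [ha, pow_add, mul_inv, mul_comm, mul_assoc, inv_mul_cancel₀ (by positivity), mul_one]
    exact inv_le_one_of_one_le₀ (one_le_pow₀ (by linarith))
  have hKa : 2 * a ≤ K * a := by gcongr
  have ha4 : 4 * a ≤ 1 := by
    refine le_trans ?_ haK
    gcongr
    nlinarith
  have hKKa : (K : ℝ) * a ≤ K ^ 2 * a := by
    gcongr; exact le_self_pow₀ (by linarith) two_ne_zero
  set r := rK K (j + 1) with hr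
  set R := rK K (j + 2) with hR
  have hr0 : 0 ≤ r := by linarith
  have hrR : r < R := by linarith
  have hR0 : 0 < R := by linarith
  have hgc : Continuous fun θ ↦ poissonKernel 0 (circleMap 0 r θ) (circleMap 0 R t) := by
    simp only [poissonKernel_def, sub_zero]
    refine Continuous.div (by fun_prop) (by fun_prop) fun θ ↦ ?_
    refine pow_ne_zero _ (norm_ne_zero_iff.2 (sub_ne_zero.2 fun h ↦ ?_))
    have := congrArg norm h
    simp only [norm_circleMap_zero, abs_of_nonneg hr0, abs_of_pos hR0] at this
    linarith
  have hmain := sum_le_of_le_mul_on_arcs (N := K ^ (j + 3))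
    (A := 3 * (K : ℝ) ^ 2 * (1 + 8 * (K : ℝ) ^ 2) ^ 2)
    (c := fun l ↦ poissonKernel 0 (circleMap 0 (ρ l) (φ l)) (circleMap 0 R t))
    (by positivity) hgc ?_
  · rw [integral_poissonKernel_circleMap hr0 hrR] at hmain
    refine hmain.trans (le_of_eq ?_)
    push_cast
    field_simp
  · intro l hl θ hθ
    push_cast at hθ
    obtain ⟨hρ1, hρ2⟩ := hρ l hl
    obtain ⟨hφ1, hφ2⟩ := hφ l hl
    rw [h0] at hρ1
    rw [h1] at hρ2
    have hρ0 : 0 ≤ ρ l := by linarith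
    have hdiff : 2 * π * (l + 1) / (K : ℝ) ^ (j + 3) - 2 * π * l / (K : ℝ) ^ (j + 3) ≤ 4 * a := by
      have : 2 * π * (l + 1) / (K : ℝ) ^ (j + 3) - 2 * π * l / (K : ℝ) ^ (j + 3) =
          2 * π / K * a := by
        rw [ha]; field_simp; ring
      rw [this]
      gcongr
      rw [div_le_iff₀ hK0]
      linarith [Real.pi_le_four]
    have habs : |φ l - θ| ≤ 4 * a := by
      rw [abs_le]; constructor <;> linarith [hθ.1, hθ.2]
    refine poissonKernel_le_mul (a := a) (R := R) (by simp [abs_of_pos hR0]) ha0 (by positivity)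
      (by positivity) ?_ ?_ ?_ ?_
    · simp only [norm_circleMap_zero, abs_of_nonneg hρ0]; linarith
    · simpa [abs_of_nonneg hr0] using hrR
    · refine (norm_circleMap_sub_circleMap_le _ _ _ _).trans ?_
      have e1 : |ρ l - r| ≤ K ^ 2 * a := by rw [abs_le]; constructor <;> linarith
      have e2 : |r| * |φ l - θ| ≤ 1 * (4 * a) := by
        gcongr
        rw [abs_of_nonneg hr0]; linarith
      linarith
    · simp only [norm_circleMap_zero, sq_abs]
      have e1 : a * (3 / 4) ≤ R ^ 2 - r ^ 2 := by
        have : a * (3 / 4) ≤ (R - r) * (R + r) := by gcongr <;> linarith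
        linarith
      have e2 : R ^ 2 - ρ l ^ 2 ≤ 2 * (K ^ 2 * a) := by
        have : (R - ρ l) * (R + ρ l) ≤ (K ^ 2 * a) * 2 := by
          gcongr <;> linarith
        linarith
      have e3 : 3 * (K : ℝ) ^ 2 * (a * (3 / 4)) ≤ 3 * (K : ℝ) ^ 2 * (R ^ 2 - r ^ 2) := by gcongr
      have : 0 ≤ (K : ℝ) ^ 2 * a := by positivity
      linarith

theorem exists_iSup_Qset_le {K j l : ℕ} (hK : 2 ≤ K) {f : ℂ → ℂ}
    (hf : ContinuousOn f (Metric.ball 0 1)) :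
    ∃ ρ ∈ Set.Icc (rK K j) (rK K (j + 1)),
      ∃ φ ∈ Set.Icc (2 * π * l / (K : ℝ) ^ (j + 3)) (2 * π * (l + 1) / (K : ℝ) ^ (j + 3)),
        ⨆ w ∈ Qset K j l, ‖f w‖ ≤ ‖f (circleMap 0 ρ φ)‖ := by
  have hK1 : (1 : ℝ) ≤ K := by exact_mod_cast (by omega : 1 ≤ K)
  have hK0 : (0 : ℝ) < K := by linarith
  set S := Set.Icc (rK K j) (rK K (j + 1)) ×ˢ
    Set.Icc (2 * π * l / (K : ℝ) ^ (j + 3)) (2 * π * (l + 1) / (K : ℝ) ^ (j + 3))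
  have hr : rK K j ≤ rK K (j + 1) := by
    unfold rK
    gcongr
    omega
  have hr0 : 0 ≤ rK K j := by
    unfold rK
    linarith [inv_le_one_of_one_le₀ (one_le_pow₀ hK1 : (1 : ℝ) ≤ (K : ℝ) ^ j)]
  have hr1 : rK K (j + 1) < 1 := by
    unfold rK
    have : (0 : ℝ) < ((K : ℝ) ^ (j + 1))⁻¹ := by positivity
    linarith
  have ht : 2 * π * l / (K : ℝ) ^ (j + 3) ≤ 2 * π * (l + 1) / (K : ℝ) ^ (j + 3) := by
    gcongr; linarith
  have hne : S.Nonempty := ⟨(rK K j, 2 * π * l / (K : ℝ) ^ (j + 3)), ⟨le_rfl, hr⟩, ⟨le_rfl, ht⟩⟩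
  have hcont : ContinuousOn (fun x : ℝ × ℝ ↦ ‖f (circleMap 0 x.1 x.2)‖) S := by
    refine (hf.comp (t := Metric.ball 0 1) (by fun_prop) fun x hx ↦ ?_).norm
    have h0 : 0 ≤ x.1 := hr0.trans hx.1.1
    simpa [abs_of_nonneg h0] using hx.1.2.trans_lt hr1
  obtain ⟨⟨ρ, φ⟩, hx, hmax⟩ := (isCompact_Icc.prod isCompact_Icc).exists_isMaxOn hne hcont
  refine ⟨ρ, hx.1, φ, hx.2, Real.iSup_le (fun w ↦ Real.iSup_le (fun hw ↦ ?_) (norm_nonneg _))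
    (norm_nonneg _)⟩
  obtain ⟨h1, h2, θ, h3, h4, h5⟩ := hw
  have := hmax (show ((‖w‖, θ) : ℝ × ℝ) ∈ S from ⟨⟨h1, h2.le⟩, ⟨h3, h4.le⟩⟩)
  rw [Set.mem_ofPred_eq] at this
  have hwc : circleMap 0 ‖w‖ θ = w := by rw [circleMap, zero_add]; exact h5.symm
  simpa only [hwc] using this

theorem MpR_rpow {p : ℝ} (hp : 0 < p) (f : ℂ → ℂ) (r : ℝ) :
    MpR p f r ^ p = Real.circleAverage (fun z ↦ ‖f z‖ ^ p) 0 r := by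
  have h0 : 0 ≤ ∫ t in (0 : ℝ)..(2 * π), ‖f (circ r t)‖ ^ p :=
    intervalIntegral.integral_nonneg (by positivity) fun t _ ↦ by positivity
  rw [MpR, ← Real.rpow_mul (by positivity), inv_mul_cancel₀ hp.ne', Real.rpow_one,
    Real.circleAverage_def, smul_eq_mul]
  simp only [circ, circleMap, zero_add]

/-- for analytic `f`,
`∑_{l<K^{j+3}} (sup_{Q_{j,l}} |f|)^p ≤ C K^j M_p^p(r_{j+2}, f)`. -/
theorem stmt14 (K : ℕ) (hK : 2 ≤ K) (p : ℝ) (hp : 0 < p) :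
    ∃ C : ℝ, 0 < C ∧ ∀ f : ℂ → ℂ, DifferentiableOn ℂ f (Metric.ball (0:ℂ) 1) →
      ∀ j : ℕ,
        (∑ l ∈ Finset.range (K ^ (j + 3)),
            (⨆ w ∈ Qset K j l, ‖f w‖) ^ p) ≤
          C * (K : ℝ) ^ j * MpR p f (rK K (j + 2)) ^ p := by
  have hK1 : (1 : ℝ) < K := by exact_mod_cast hK
  have hK0 : (0 : ℝ) < K := by linarith
  refine ⟨3 * (K : ℝ) ^ 2 * (1 + 8 * (K : ℝ) ^ 2) ^ 2 * (K : ℝ) ^ 3, by positivity,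
    fun f hf j ↦ ?_⟩
  choose ρ hρ φ hφ hsup using fun l : ℕ ↦ exists_iSup_Qset_le (j := j) (l := l) hK hf.continuousOn
  set R := rK K (j + 2) with hR
  have hρ0 : ∀ l, 0 ≤ ρ l := fun l ↦ by
    refine le_trans ?_ (hρ l).1
    unfold rK
    linarith [inv_le_one_of_one_le₀ (one_le_pow₀ hK1.le : (1 : ℝ) ≤ (K : ℝ) ^ j)]
  have hρR : ∀ l, ρ l < R := fun l ↦ by
    refine (hρ l).2.trans_lt ?_
    rw [hR]
    unfold rK
    gcongr
    omega
  have hR0 : 0 < R := (hρ0 0).trans_lt (hρR 0)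
  have hR1 : R < 1 := by
    rw [hR]
    unfold rK
    have : (0 : ℝ) < ((K : ℝ) ^ (j + 2))⁻¹ := by positivity
    linarith
  have hfan : AnalyticOnNhd ℂ f (Metric.closedBall 0 R) :=
    (hf.analyticOnNhd Metric.isOpen_ball).mono (Metric.closedBall_subset_ball hR1)
  have hnorm : ∀ z ∈ Metric.sphere (0 : ℂ) R, ‖z‖ = R := fun z hz ↦ by simpa using hz
  have hcont : ContinuousOn (fun z ↦ ‖f z‖ ^ p) (Metric.sphere 0 R) :=
    (hfan.continuousOn.mono Metric.sphere_subset_closedBall).norm.rpow_const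
      fun _ _ ↦ Or.inr hp.le
  have hint : ∀ l, CircleIntegrable
      (fun z ↦ poissonKernel 0 (circleMap 0 (ρ l) (φ l)) z * ‖f z‖ ^ p) 0 R := fun l ↦
    (((continuousOn_poissonKernel _ R).mono fun z hz ↦ by
      simpa [hnorm z hz, abs_of_nonneg (hρ0 l)] using hρR l).mul hcont).circleIntegrable hR0.le
  calc ∑ l ∈ Finset.range (K ^ (j + 3)), (⨆ w ∈ Qset K j l, ‖f w‖) ^ p
      ≤ ∑ l ∈ Finset.range (K ^ (j + 3)), Real.circleAverage
          (fun z ↦ poissonKernel 0 (circleMap 0 (ρ l) (φ l)) z * ‖f z‖ ^ p) 0 R := by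
        refine Finset.sum_le_sum fun l _ ↦ le_trans ?_
          (rpow_norm_le_circleAverage_poissonKernel hp hfan
            (w := circleMap 0 (ρ l) (φ l)) (by simpa [abs_of_nonneg (hρ0 l)] using hρR l))
        exact Real.rpow_le_rpow (Real.iSup_nonneg fun w ↦ Real.iSup_nonneg fun _ ↦ norm_nonneg _)
          (hsup l) hp.le
    _ = Real.circleAverage (fun z ↦ ∑ l ∈ Finset.range (K ^ (j + 3)),
          poissonKernel 0 (circleMap 0 (ρ l) (φ l)) z * ‖f z‖ ^ p) 0 R :=
        (Real.circleAverage_fun_sum fun l _ ↦ hint l).symm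
    _ ≤ Real.circleAverage (fun z ↦ (3 * (K : ℝ) ^ 2 * (1 + 8 * (K : ℝ) ^ 2) ^ 2 *
          (K : ℝ) ^ (j + 3)) • ‖f z‖ ^ p) 0 R := by
        refine Real.circleAverage_mono (CircleIntegrable.fun_sum _ fun l _ ↦ hint l)
          ((hcont.fun_const_smul _).circleIntegrable hR0.le) fun z hz ↦ ?_
        rw [abs_of_pos hR0] at hz
        obtain ⟨t, rfl⟩ : z ∈ Set.range (circleMap 0 R) := by
          rwa [range_circleMap, abs_of_pos hR0]
        rw [← Finset.sum_mul, smul_eq_mul]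
        gcongr
        exact sum_poissonKernel_le hK (fun l _ ↦ hρ l) (fun l _ ↦ hφ l) t
    _ = _ := by
        rw [Real.circleAverage_fun_smul, MpR_rpow hp, smul_eq_mul]
        ring

end
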